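/- When WSU-UX with K = 2 arms and any valid hyperparameter setting (η, γ) is run on the hard loss sequence, conditional on the event E2 the following holds: setting t₀ = T₁ + T₂ + 1, for every 1 ≤ τ ≤ T₃ + T₄ and t = t₀ + τ, E[π_{t,2} | E2] ≤ (3/4)·exp(−(η/4)·τ). -/

import Mathlib

open MeasureTheory ProbabilityTheory Real Finset

noncomputable section

/-- A run of the WSU-UX bandit algorithm with `K` expert arms, horizon `T`,
learning rate `η`, exploration parameter `γ`, on the oblivious loss sequence `ℓ`
(rounds are indexed `1, …, T`; arms are indexed by `Fin K`, with arm 1 = index `0`).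

The data consists of a filtration `F`, the arms `I t` drawn at each round, and the
probability vectors `π t` maintained by the algorithm, subject to:
* `π 1 i = 1/K` (initialization);
* `π t` is `F (t-1)`-measurable and the conditional law of `I t` given `F (t-1)` is
  `π̃ t i = (1-γ) π t i + γ/K` (uniform-exploration mixing);
* the WSU update `π (t+1) i = π t i (1 - η (ℓ̂ t i - Σ_j π t j ℓ̂ t j))`, where
  `ℓ̂ t i = ℓ t i · 1[I t = i] / π̃ t i` is the importance-weighted loss estimate. -/
structure WSUUX (K T : ℕ) (η γ : ℝ) (ℓ : ℕ → Fin K → ℝ) (Ω : Type)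
    [MeasurableSpace Ω] (P : Measure Ω) where
  F : ℕ → MeasurableSpace Ω
  F_le : ∀ t, F t ≤ ‹MeasurableSpace Ω›
  F_mono : Monotone F
  I : ℕ → Ω → Fin K
  I_meas : ∀ t, Measurable[F t] (I t)
  pi : ℕ → Ω → Fin K → ℝ
  pi_meas : ∀ t i, Measurable[F (t - 1)] fun ω => pi t ω i
  pi_init : ∀ ω i, pi 1 ω i = 1 / K
  law : ∀ t, 1 ≤ t → ∀ i,
    P[(fun ω => if I t ω = i then (1 : ℝ) else 0)|F (t - 1)] =ᵐ[P]
      fun ω => (1 - γ) * pi t ω i + γ / K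
  update : ∀ t, 1 ≤ t → ∀ ω i,
    pi (t + 1) ω i = pi t ω i * (1 - η *
      (ℓ t i * (if I t ω = i then 1 else 0) / ((1 - γ) * pi t ω i + γ / K)
        - ∑ j, pi t ω j *
            (ℓ t j * (if I t ω = j then 1 else 0) / ((1 - γ) * pi t ω j + γ / K))))

namespace WSUUX

variable {K T : ℕ} {η γ : ℝ} {ℓ : ℕ → Fin K → ℝ} {Ω : Type} [MeasurableSpace Ω]
  {P : Measure Ω}

/-- The exploration-mixed sampling distribution `π̃_{t,i} = (1-γ) π_{t,i} + γ/K`. -/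
def ptilde (run : WSUUX K T η γ ℓ Ω P) (t : ℕ) (ω : Ω) (i : Fin K) : ℝ :=
  (1 - γ) * run.pi t ω i + γ / K

/-- The importance-weighted loss estimate `ℓ̂_{t,i} = ℓ_{t,i} · 1[I_t = i] / π̃_{t,i}`. -/
def lhat (run : WSUUX K T η γ ℓ Ω P) (t : ℕ) (ω : Ω) (i : Fin K) : ℝ :=
  ℓ t i * (if run.I t ω = i then 1 else 0) / run.ptilde t ω i

/-- The expected regret
`E[Σ_{t=1}^T Σ_j π̃_{t,j} ℓ_{t,j}] − min_i Σ_{t=1}^T ℓ_{t,i}`. -/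
def regret (run : WSUUX K T η γ ℓ Ω P) : ℝ :=
  (∫ ω, ∑ t ∈ Finset.Icc 1 T, ∑ j, run.ptilde t ω j * ℓ t j ∂P)
    - ⨅ i : Fin K, ∑ t ∈ Finset.Icc 1 T, ℓ t i

end WSUUX

/-- Valid hyperparameters: `η, γ ∈ (0, 1/2)` and `ηK/γ ≤ 1/2`. -/
def validParams (K : ℕ) (η γ : ℝ) : Prop :=
  0 < η ∧ η < 1 / 2 ∧ 0 < γ ∧ γ < 1 / 2 ∧ η * K / γ ≤ 1 / 2

/-- The non-trivial hyperparameter regime: `η ≥ T^{-2/3}` and `γ ≤ T^{-1/3}`. -/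
def nontrivialRegime (T : ℕ) (η γ : ℝ) : Prop :=
  (T : ℝ) ^ (-(2 : ℝ) / 3) ≤ η ∧ γ ≤ (T : ℝ) ^ (-(1 : ℝ) / 3)

/-- The hard loss sequence for `K = 2` arms: arm 1 (index `0`) has loss `1` and
arm 2 (index `1`) has loss `0` for `1 ≤ t ≤ T/100` (Phase 1), and the losses are
swapped for `T/100 < t ≤ T` (Phase 2). -/
def hardLoss (T : ℕ) : ℕ → Fin 2 → ℝ := fun t i =>
  if t ≤ T / 100 then (if i = 0 then 1 else 0) else (if i = 0 then 0 else 1)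

end

namespace WSUUX

section HardLoss

variable {T : ℕ} {η γ : ℝ} {Ω : Type} [MeasurableSpace Ω] {P : Measure Ω}

/-- The importance weight of a drawn arm, scaled by the learning rate. -/
noncomputable def scaledWeight (run : WSUUX 2 T η γ (hardLoss T) Ω P) (t : ℕ) (ω : Ω)
    (i : Fin 2) : ℝ :=
  η * ((if run.I t ω = i then 1 else 0) / run.ptilde t ω i)

lemma update_of_le (run : WSUUX 2 T η γ (hardLoss T) Ω P) {t : ℕ} (ht : 1 ≤ t)
    (htT : t ≤ T / 100) (ω : Ω) :
    run.pi (t + 1) ω 0 =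
        run.pi t ω 0 * (1 - run.scaledWeight t ω 0 * (1 - run.pi t ω 0)) ∧
      run.pi (t + 1) ω 1 = run.pi t ω 1 * (1 + run.scaledWeight t ω 0 * run.pi t ω 0) := by
  rw [run.update t ht ω 0, run.update t ht ω 1]
  simp only [hardLoss, htT, if_true, Fin.sum_univ_two, scaledWeight, ptilde, one_ne_zero,
    if_false, one_mul, zero_mul, zero_div, mul_zero]
  constructor <;> ring

lemma update_of_lt (run : WSUUX 2 T η γ (hardLoss T) Ω P) {t : ℕ} (ht : 1 ≤ t)
    (htT : T / 100 < t) (ω : Ω) :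
    run.pi (t + 1) ω 0 = run.pi t ω 0 * (1 + run.scaledWeight t ω 1 * run.pi t ω 1) ∧
      run.pi (t + 1) ω 1 =
        run.pi t ω 1 * (1 - run.scaledWeight t ω 1 * (1 - run.pi t ω 1)) := by
  rw [run.update t ht ω 0, run.update t ht ω 1]
  simp only [hardLoss, htT.not_ge, if_true, Fin.sum_univ_two, scaledWeight, ptilde, one_ne_zero,
    if_false, one_mul, zero_mul, zero_div, mul_zero]
  constructor <;> ring

lemma half_le_ptilde (run : WSUUX 2 T η γ (hardLoss T) Ω P) (hγ : γ < 1 / 2) {t : ℕ}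
    {ω : Ω} {i : Fin 2} (h : 0 ≤ run.pi t ω i) : γ / 2 ≤ run.ptilde t ω i := by
  have := mul_nonneg (show (0 : ℝ) ≤ 1 - γ by linarith) h
  simp only [ptilde, Nat.cast_ofNat]
  linarith

lemma scaledWeight_mem_Icc (run : WSUUX 2 T η γ (hardLoss T) Ω P)
    (hvalid : validParams 2 η γ) {t : ℕ} {ω : Ω} {i : Fin 2} (h : 0 ≤ run.pi t ω i) :
    run.scaledWeight t ω i ∈ Set.Icc (0 : ℝ) 1 := by
  obtain ⟨hη, -, hγ, hγ', hηγ⟩ := hvalid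
  have hq := run.half_le_ptilde hγ' h
  have hq0 : 0 < run.ptilde t ω i := by linarith
  rw [Nat.cast_ofNat, div_le_iff₀ hγ] at hηγ
  unfold scaledWeight
  split_ifs
  · refine ⟨by positivity, ?_⟩
    rw [mul_one_div, div_le_one hq0]
    linarith
  · simp

lemma pi_nonneg_and_add_eq_one (run : WSUUX 2 T η γ (hardLoss T) Ω P)
    (hvalid : validParams 2 η γ) {t : ℕ} (ht : 1 ≤ t) (ω : Ω) :
    0 ≤ run.pi t ω 0 ∧ 0 ≤ run.pi t ω 1 ∧ run.pi t ω 0 + run.pi t ω 1 = 1 := by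
  induction t, ht using Nat.le_induction with
  | base => simp only [run.pi_init]; norm_num
  | succ t ht ih =>
    obtain ⟨h0, h1, hsum⟩ := ih
    have e1 : run.pi t ω 1 = 1 - run.pi t ω 0 := by linarith
    rcases le_or_gt t (T / 100) with htT | htT
    · obtain ⟨u0, u1⟩ := run.update_of_le ht htT ω
      obtain ⟨w0, w1⟩ := run.scaledWeight_mem_Icc hvalid h0
      rw [u0, u1]
      refine ⟨mul_nonneg h0 ?_, by positivity, by rw [e1]; ring⟩
      linarith [mul_le_one₀ w1 (by linarith) (show 1 - run.pi t ω 0 ≤ 1 by linarith)]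
    · obtain ⟨u0, u1⟩ := run.update_of_lt ht htT ω
      obtain ⟨w0, w1⟩ := run.scaledWeight_mem_Icc hvalid h1
      rw [u0, u1]
      refine ⟨by positivity, mul_nonneg h1 ?_, by rw [e1]; ring⟩
      linarith [mul_le_one₀ w1 (by linarith) (show 1 - run.pi t ω 1 ≤ 1 by linarith)]

/-- In the second phase the weight of arm 1 never decreases. -/
lemma pi_zero_mono_of_lt (run : WSUUX 2 T η γ (hardLoss T) Ω P)
    (hvalid : validParams 2 η γ) {s t : ℕ} (hs : 1 ≤ s) (hsT : T / 100 < s) (hst : s ≤ t)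
    (ω : Ω) : run.pi s ω 0 ≤ run.pi t ω 0 := by
  induction t, hst using Nat.le_induction with
  | base => exact le_rfl
  | succ t hst ih =>
    obtain ⟨h0, h1, -⟩ := run.pi_nonneg_and_add_eq_one hvalid (hs.trans hst) ω
    obtain ⟨w0, -⟩ := run.scaledWeight_mem_Icc hvalid h1
    rw [(run.update_of_lt (hs.trans hst) (hsT.trans_le hst) ω).1]
    refine ih.trans (le_mul_of_one_le_right h0 ?_)
    linarith [mul_nonneg w0 h1]

lemma measurable_pi (run : WSUUX 2 T η γ (hardLoss T) Ω P) (t : ℕ) (i : Fin 2) :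
    Measurable fun ω => run.pi t ω i :=
  (run.pi_meas t i).mono (run.F_le _) le_rfl

lemma integrable_pi_one [IsFiniteMeasure P] (run : WSUUX 2 T η γ (hardLoss T) Ω P)
    (hvalid : validParams 2 η γ) {t : ℕ} (ht : 1 ≤ t) :
    Integrable (fun ω => run.pi t ω 1) P := by
  refine .of_bound (run.measurable_pi t 1).aestronglyMeasurable 1 (.of_forall fun ω => ?_)
  obtain ⟨h0, h1, hsum⟩ := run.pi_nonneg_and_add_eq_one hvalid ht ω
  rw [Real.norm_of_nonneg h1]
  linarith

/-- Conditionally on the past, the importance weight averages out of the drift of `π_{t,2}`. -/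
lemma setIntegral_pi_one_succ [IsFiniteMeasure P]
    (run : WSUUX 2 T η γ (hardLoss T) Ω P) (hvalid : validParams 2 η γ) {t : ℕ} (ht : 1 ≤ t)
    (htT : T / 100 < t) {E : Set Ω} (hE : MeasurableSet[run.F (t - 1)] E) :
    ∫ ω in E, run.pi (t + 1) ω 1 ∂P =
      ∫ ω in E, (run.pi t ω 1 - η * (run.pi t ω 1 * run.pi t ω 0)) ∂P := by
  have hm := run.F_le (t - 1)
  have hinv := run.pi_nonneg_and_add_eq_one hvalid ht
  have hq : ∀ ω, 0 < run.ptilde t ω 1 := fun ω =>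
    (half_pos hvalid.2.2.1).trans_le (run.half_le_ptilde hvalid.2.2.2.1 (hinv ω).2.1)
  set X : Ω → ℝ := fun ω => if run.I t ω = 1 then 1 else 0 with hX
  set g : Ω → ℝ := fun ω => η * (run.pi t ω 1 * run.pi t ω 0) / run.ptilde t ω 1 with hg
  have hXm : Measurable X := by
    have hI : Measurable (run.I t) := (run.I_meas t).mono (run.F_le t) le_rfl
    exact .ite (hI (measurableSet_singleton 1)) measurable_const measurable_const
  have hgm : Measurable[run.F (t - 1)] g := by
    have h0 := run.pi_meas t 0
    have h1 := run.pi_meas t 1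
    unfold g ptilde
    exact (measurable_const.mul (h1.mul h0)).div ((measurable_const.mul h1).add measurable_const)
  have hXi : Integrable X P := by
    refine .of_bound hXm.aestronglyMeasurable 1 (.of_forall fun ω => ?_)
    simp only [hX]; split_ifs <;> simp
  have hstep : ∀ ω, run.pi (t + 1) ω 1 = run.pi t ω 1 - (g * X) ω := fun ω => by
    rw [(run.update_of_lt ht htT ω).2, show 1 - run.pi t ω 1 = run.pi t ω 0 by
      linarith [(hinv ω).2.2]]
    simp only [hg, hX, Pi.mul_apply, scaledWeight]
    ring
  have hpi := run.integrable_pi_one hvalid ht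
  have hgX : Integrable (g * X) P := by
    refine (hpi.sub (run.integrable_pi_one hvalid (Nat.le_add_left 1 t))).congr
      (.of_forall fun ω => ?_)
    simp only [Pi.sub_apply, hstep ω]; ring
  have hcond : P[g * X|run.F (t - 1)] =ᵐ[P] fun ω => η * (run.pi t ω 1 * run.pi t ω 0) := by
    filter_upwards [condExp_mul_of_stronglyMeasurable_left hgm.stronglyMeasurable hgX hXi,
      run.law t ht 1] with ω h1 h2
    rw [h1, Pi.mul_apply, h2]
    exact div_mul_cancel₀ _ (hq ω).ne'
  have hci : Integrable (fun ω => η * (run.pi t ω 1 * run.pi t ω 0)) P :=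
    integrable_condExp.congr hcond
  simp only [hstep]
  rw [integral_sub hpi.integrableOn hgX.integrableOn,
    integral_sub hpi.integrableOn hci.integrableOn, ← setIntegral_condExp hm hgX hE,
    setIntegral_congr_ae (hm _ hE) (hcond.mono fun ω h _ => h)]

/-- Exponential decay of `π_{t,2}` in the second phase, on the event that arm 1 has weight at
least `c`. -/
lemma setIntegral_pi_one_le [IsFiniteMeasure P]
    (run : WSUUX 2 T η γ (hardLoss T) Ω P) (hvalid : validParams 2 η γ) {s : ℕ} (hs : 1 ≤ s)
    (hsT : T / 100 < s) (c : ℝ) (n : ℕ) :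
    ∫ ω in {ω | c ≤ run.pi s ω 0}, run.pi (s + n) ω 1 ∂P ≤
      (1 - c) * Real.exp (-(η * c) * n) * P.real {ω | c ≤ run.pi s ω 0} := by
  set E := {ω | c ≤ run.pi s ω 0} with hE_def
  have hE : MeasurableSet[run.F (s - 1)] E := run.pi_meas s 0 measurableSet_Ici
  have hE' : MeasurableSet E := run.F_le _ _ hE
  have hi : ∀ k, Integrable (fun ω => run.pi (s + k) ω 1) P := fun k =>
    run.integrable_pi_one hvalid (by lia)
  induction n with
  | zero =>
    have : ∫ ω in E, run.pi (s + 0) ω 1 ∂P ≤ ∫ _ in E, (1 - c) ∂P := by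
      refine setIntegral_mono_on (hi 0).integrableOn (integrableOn_const (by simp)) hE'
        fun ω hω => ?_
      have hω' : c ≤ run.pi s ω 0 := hω
      have := (run.pi_nonneg_and_add_eq_one hvalid hs ω).2.2
      simp only [add_zero]
      linarith
    simpa [mul_comm] using this
  | succ n ih =>
    have h1 : 1 ≤ s + n := by lia
    rw [← add_assoc, run.setIntegral_pi_one_succ hvalid h1 (by lia)
      (run.F_mono (by lia : s - 1 ≤ s + n - 1) _ hE)]
    have hnonneg : 0 ≤ ∫ ω in E, run.pi (s + n) ω 1 ∂P :=
      integral_nonneg fun ω => (run.pi_nonneg_and_add_eq_one hvalid h1 ω).2.1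
    calc ∫ ω in E, (run.pi (s + n) ω 1 - η * (run.pi (s + n) ω 1 * run.pi (s + n) ω 0)) ∂P
        ≤ ∫ ω in E, (1 - η * c) * run.pi (s + n) ω 1 ∂P := by
          refine setIntegral_mono_on ?_ ((hi n).const_mul _).integrableOn hE' fun ω hω => ?_
          · refine (Integrable.sub (hi n) (Integrable.const_mul ?_ η)).integrableOn
            refine (hi n).mul_bdd (c := 1) (run.measurable_pi _ 0).aestronglyMeasurable
              (.of_forall fun ω => ?_)
            obtain ⟨h0, h1, hsum⟩ := run.pi_nonneg_and_add_eq_one hvalid h1 ω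
            rw [Real.norm_of_nonneg h0]
            linarith
          · have hω' : c ≤ run.pi (s + n) ω 0 :=
              le_trans hω (run.pi_zero_mono_of_lt hvalid hs hsT (by lia) ω)
            have hp := (run.pi_nonneg_and_add_eq_one hvalid h1 ω).2.1
            linarith [mul_le_mul_of_nonneg_left hω' (mul_nonneg hvalid.1.le hp)]
      _ = (1 - η * c) * ∫ ω in E, run.pi (s + n) ω 1 ∂P := integral_const_mul _ _
      _ ≤ Real.exp (-(η * c)) * ∫ ω in E, run.pi (s + n) ω 1 ∂P :=
          mul_le_mul_of_nonneg_right (Real.one_sub_le_exp_neg _) hnonneg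
      _ ≤ Real.exp (-(η * c)) * ((1 - c) * Real.exp (-(η * c) * n) * P.real E) :=
          mul_le_mul_of_nonneg_left ih (Real.exp_pos _).le
      _ = (1 - c) * Real.exp (-(η * c) * (n + 1 : ℕ)) * P.real E := by
          rw [show -(η * c) * ((n + 1 : ℕ) : ℝ) = -(η * c) + -(η * c) * n by push_cast; ring,
            Real.exp_add]
          ring

end HardLoss

end WSUUX

/-- When WSU-UX with `K = 2` arms and any valid `(η, γ)` is run on the
hard loss sequence, conditional on the event `E2 = {π_{T₁+T₂+1,1} ≥ 1/4}`
(with `T₁ = T/100`, `T₂ = 2T/10`, `T₃ = T/10`, `T₄ = 69T/100`): setting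
`t₀ = T₁ + T₂ + 1`, for every `1 ≤ τ ≤ T₃ + T₄` and `t = t₀ + τ`,
`E[π_{t,2} | E2] ≤ (3/4)·exp(−(η/4)·τ)`. -/
theorem wsuux_conditional_decay (T : ℕ) (η γ : ℝ) (hvalid : validParams 2 η γ)
    (Ω : Type) [MeasurableSpace Ω] (P : Measure Ω) [IsProbabilityMeasure P]
    (run : WSUUX 2 T η γ (hardLoss T) Ω P)
    (τ : ℕ) (hτ1 : 1 ≤ τ) (hτ2 : τ ≤ T / 10 + 69 * T / 100) :
    ∫ ω, run.pi (T / 100 + 2 * T / 10 + 1 + τ) ω 1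
        ∂(ProbabilityTheory.cond P
            {ω | (1 / 4 : ℝ) ≤ run.pi (T / 100 + 2 * T / 10 + 1) ω 0})
      ≤ 3 / 4 * Real.exp (-(η / 4) * τ) := by
  have h := run.setIntegral_pi_one_le hvalid (s := T / 100 + 2 * T / 10 + 1) (by lia) (by lia)
    (1 / 4) τ
  rw [ProbabilityTheory.cond, integral_smul_measure, ENNReal.toReal_inv, smul_eq_mul,
    show -(η / 4) = -(η * (1 / 4)) by ring]
  refine inv_mul_le_of_le_mul₀ measureReal_nonneg (by positivity) ?_
  rw [← measureReal_def, mul_comm (P.real _)]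
  norm_num at h ⊢
  exact h
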